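/- Fix θ > 0. For each N let σ_N be an Ewens(θ)-distributed random permutation of S_N, and let A^{(N)} be the number of adjacencies of σ_N, i.e. the number of indices i ∈ [N−1] with σ_N(i+1) = σ_N(i) + 1 or σ_N(i+1) = σ_N(i) − 1. Then A^{(N)} converges in distribution, as N → ∞, to a Poisson random variable with parameter 2. -/

import Mathlib

open scoped BigOperators Classical
open Finset

noncomputable section

/-- Total number of cycles of a permutation of `Fin N`, fixed points included. -/
def cycleCount {N : ℕ} (σ : Equiv.Perm (Fin N)) : ℕ :=
  Multiset.card σ.cycleType + (N - σ.cycleType.sum)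

/-- Expectation of `f` under the Ewens measure with parameter `θ` on `S_N`. -/
def ewensE (θ : ℝ) (N : ℕ) (f : Equiv.Perm (Fin N) → ℝ) : ℝ :=
  (∑ σ : Equiv.Perm (Fin N), θ ^ cycleCount σ * f σ) / ∏ k ∈ Finset.range N, (θ + (k : ℝ))

/-- Probability of an event under the Ewens measure. -/
def ewensP (θ : ℝ) (N : ℕ) (A : Set (Equiv.Perm (Fin N))) : ℝ :=
  ewensE θ N (fun σ => if σ ∈ A then 1 else 0)

/-- The Bernoulli random variable `B^{(N)}_{i,s}`, equal to 1 iff `σ i = s`. -/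
def Bis {N : ℕ} (i s : Fin N) (σ : Equiv.Perm (Fin N)) : ℝ :=
  if σ i = s then 1 else 0

/-- The set partitions of a finset `S`, encoded as finsets of nonempty disjoint finsets
covering `S`. -/
def partitionsOf {ι : Type*} [DecidableEq ι] (S : Finset ι) : Finset (Finset (Finset ι)) :=
  S.powerset.powerset.filter
    (fun P => (∀ C ∈ P, C.Nonempty) ∧ ∀ j ∈ S, ∃! C, C ∈ P ∧ j ∈ C)

/-- The joint cumulant of the family of random variables indexed by `S`, expressed through
the moments function `M` : `κ = Σ_π (−1)^{#π−1} (#π−1)! Π_{C ∈ π} M C`. -/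
def cumulantOn {ι 𝕜 : Type*} [DecidableEq ι] [Field 𝕜] (S : Finset ι) (M : Finset ι → 𝕜) : 𝕜 :=
  ∑ P ∈ partitionsOf S,
    (-1 : 𝕜) ^ (P.card - 1) * ((P.card - 1).factorial : 𝕜) * ∏ C ∈ P, M C


/-- Number of adjacencies of `σ`: indices `i ∈ [N−1]` with `σ(i+1) = σ(i) ± 1`. -/
def adjCount {N : ℕ} (σ : Equiv.Perm (Fin N)) : ℕ :=
  (Finset.univ.filter (fun i : Fin N => ∃ i' : Fin N, (i' : ℕ) = (i : ℕ) + 1 ∧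
    ((σ i' : ℕ) = (σ i : ℕ) + 1 ∨ (σ i' : ℕ) + 1 = (σ i : ℕ)))).card

lemma sameCycle_apply_eq {α β : Type*} {σ : Equiv.Perm α} {f : α → β}
    (hf : ∀ x, f (σ x) = f x) {x y : α} (h : σ.SameCycle x y) : f x = f y := by
  obtain ⟨k, rfl⟩ := h
  induction k with
  | zero => simp
  | succ k ih => rw [add_comm, zpow_add, Equiv.Perm.mul_apply, zpow_one, hf, ← ih]
  | pred k ih =>
    rw [ih, ← hf ((σ ^ (-(k : ℤ) - 1)) x), ← Equiv.Perm.mul_apply, ← zpow_one_add]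
    congr 3
    ring

/-- The type of cycles of a permutation, fixed points included. -/
abbrev Cycles {α : Type*} (σ : Equiv.Perm α) : Type _ :=
  Quotient (Equiv.Perm.SameCycle.setoid σ)

/-- The cycle of a point. -/
def cycleMk {α : Type*} (σ : Equiv.Perm α) (x : α) : Cycles σ :=
  Quotient.mk (Equiv.Perm.SameCycle.setoid σ) x

lemma cycleMk_eq_iff {α : Type*} {σ : Equiv.Perm α} {x y : α} :
    cycleMk σ x = cycleMk σ y ↔ σ.SameCycle x y :=
  Quotient.eq (r := Equiv.Perm.SameCycle.setoid σ)

lemma cycleMk_apply {α : Type*} (σ : Equiv.Perm α) (x : α) :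
    cycleMk σ (σ x) = cycleMk σ x :=
  cycleMk_eq_iff.2 (Equiv.Perm.sameCycle_apply_left.2 (Equiv.Perm.SameCycle.refl _ _))

lemma cycleMk_surjective {α : Type*} (σ : Equiv.Perm α) : Function.Surjective (cycleMk σ) :=
  Quotient.mk_surjective

lemma exists_cycles_lift {α β : Type*} {σ : Equiv.Perm α} {f : α → β}
    (hf : ∀ x, f (σ x) = f x) : ∃ F : Cycles σ → β, ∀ x, F (cycleMk σ x) = f x :=
  ⟨fun q => Quotient.lift (s := Equiv.Perm.SameCycle.setoid σ) f
    (fun _ _ h => sameCycle_apply_eq hf h) q, fun _ => rfl⟩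

lemma cycleCount_eq_card_cycles {N : ℕ} (σ : Equiv.Perm (Fin N)) :
    cycleCount σ = Nat.card (Cycles σ) := by
  let φ : Fin N → Equiv.Perm (Fin N) ⊕ Fin N :=
    fun x => if σ x = x then Sum.inr x else Sum.inl (σ.cycleOf x)
  have hφ : ∀ x, φ (σ x) = φ x := by
    intro x
    by_cases h : σ x = x
    · rw [h]
    · have h' : σ (σ x) ≠ σ x := fun h' => h (σ.injective h')
      simp only [φ, h, h', if_false]
      congr 1
      exact (Equiv.Perm.SameCycle.cycleOf_eq
        (Equiv.Perm.sameCycle_apply_left.2 (Equiv.Perm.SameCycle.refl _ _)))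
  obtain ⟨F, hF⟩ := exists_cycles_lift hφ
  have hinj : Function.Injective F := by
    intro p q hpq
    obtain ⟨x, rfl⟩ := cycleMk_surjective σ p
    obtain ⟨y, rfl⟩ := cycleMk_surjective σ q
    rw [hF, hF] at hpq
    by_cases hx : σ x = x <;> by_cases hy : σ y = y <;> simp [φ, hx, hy] at hpq
    · rw [hpq]
    · rw [cycleMk_eq_iff]
      have hx' : x ∈ σ.support := by simpa using hx
      exact (Equiv.Perm.sameCycle_iff_cycleOf_eq_of_mem_support hx' (by simpa using hy)).2 hpq
  have hrange : Set.range F = ((σ.cycleFactorsFinset.disjSum (univ \ σ.support) :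
      Finset (Equiv.Perm (Fin N) ⊕ Fin N)) : Set _) := by
    ext z
    simp only [Set.mem_range, Finset.mem_coe, Finset.mem_disjSum]
    constructor
    · rintro ⟨p, rfl⟩
      obtain ⟨x, rfl⟩ := cycleMk_surjective σ p
      rw [hF]
      by_cases hx : σ x = x
      · exact Or.inr ⟨x, by simp [hx], by simp [φ, hx]⟩
      · exact Or.inl ⟨σ.cycleOf x, Equiv.Perm.cycleOf_mem_cycleFactorsFinset_iff.2
          (by simpa using hx), by simp [φ, hx]⟩
    · rintro (⟨c, hc, rfl⟩ | ⟨x, hx, rfl⟩)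
      · obtain ⟨x, hx⟩ := (Equiv.Perm.mem_cycleFactorsFinset_iff.1 hc).1.nonempty_support
        refine ⟨cycleMk σ x, ?_⟩
        have h1 := Equiv.Perm.cycle_is_cycleOf hx hc
        have h2 : σ x ≠ x := by
          simpa using Equiv.Perm.mem_cycleFactorsFinset_support_le hc hx
        rw [hF, h1]
        simp [φ, h2]
      · refine ⟨cycleMk σ x, ?_⟩
        rw [hF]
        simp only [mem_sdiff, mem_univ, true_and, Equiv.Perm.notMem_support] at hx
        simp [φ, hx]
  rw [← Set.ncard_range_of_injective hinj, hrange, Set.ncard_coe_finset, Finset.card_disjSum,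
    cycleCount, Equiv.Perm.sum_cycleType, Finset.card_sdiff_of_subset (Finset.subset_univ _),
    Equiv.Perm.cycleType_def]
  simp

lemma card_cycles_le_card_cycles_swap_mul {N : ℕ} (σ : Equiv.Perm (Fin N)) (b c : Fin N) :
    Nat.card (Cycles σ) ≤ Nat.card (Cycles (Equiv.swap b c * σ)) + 1 := by
  have hf : ∀ x, (if cycleMk σ ((Equiv.swap b c * σ) x) = cycleMk σ b then cycleMk σ c
      else cycleMk σ ((Equiv.swap b c * σ) x)) =
      if cycleMk σ x = cycleMk σ b then cycleMk σ c else cycleMk σ x := by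
    intro x
    rw [← cycleMk_apply σ x, Equiv.Perm.mul_apply]
    rcases eq_or_ne (σ x) b with h | h
    · rw [h]; simp
    rcases eq_or_ne (σ x) c with h' | h'
    · rw [h']; simp
    · rw [Equiv.swap_apply_of_ne_of_ne h h']
  obtain ⟨F, hF⟩ := exists_cycles_lift
    (f := fun x => if cycleMk σ x = cycleMk σ b then cycleMk σ c else cycleMk σ x) hf
  have hs : Function.Surjective (fun o : Option (Cycles (Equiv.swap b c * σ)) =>
      o.elim (cycleMk σ b) F) := by
    intro q
    obtain ⟨x, rfl⟩ := cycleMk_surjective σ q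
    by_cases h : cycleMk σ x = cycleMk σ b
    · exact ⟨none, h.symm⟩
    · exact ⟨some (cycleMk _ x), by simp [hF, h]⟩
  have := Nat.card_le_card_of_surjective _ hs
  rwa [Finite.card_option] at this

lemma card_cycles_decomposeFin_symm {n : ℕ} (p : Fin (n + 1)) (e : Equiv.Perm (Fin n)) :
    Nat.card (Cycles (Equiv.Perm.decomposeFin.symm (p, e))) =
      Nat.card (Cycles e) + if p = 0 then 1 else 0 := by
  set σ := Equiv.Perm.decomposeFin.symm (p, e) with hσ
  have h0 : σ 0 = p := Equiv.Perm.decomposeFin_symm_apply_zero p e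
  have hsucc : ∀ x : Fin n, σ x.succ = Equiv.swap 0 p (e x).succ :=
    fun x => Equiv.Perm.decomposeFin_symm_apply_succ e p x
  obtain ⟨G, hG⟩ : ∃ G : Cycles e → Cycles σ, ∀ x, G (cycleMk e x) = cycleMk σ x.succ := by
    refine exists_cycles_lift fun x => ?_
    rw [← cycleMk_apply σ x.succ, hsucc]
    rcases eq_or_ne (e x).succ p with h | h
    · rw [h, Equiv.swap_apply_right, ← cycleMk_apply σ 0, h0]
    · rw [Equiv.swap_apply_of_ne_of_ne (Fin.succ_ne_zero _) h]
  rcases Fin.eq_zero_or_eq_succ p with hp | ⟨y, hp⟩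
  · obtain ⟨F, hF⟩ := exists_cycles_lift (σ := σ)
      (f := Fin.cases (motive := fun _ => Option (Cycles e)) none (fun x => some (cycleMk e x)))
      (by
        intro x
        refine Fin.cases ?_ (fun x => ?_) x
        · rw [h0, hp]
        · rw [hsucc, hp]; simp [cycleMk_apply])
    let E : Cycles σ ≃ Option (Cycles e) :=
      { toFun := F
        invFun := fun o => o.elim (cycleMk σ 0) G
        left_inv := by
          intro q
          obtain ⟨x, rfl⟩ := cycleMk_surjective σ q
          rw [hF]
          refine Fin.cases rfl (fun x => ?_) x
          simp [hG]
        right_inv := by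
          rintro (_ | q)
          · simp [hF]
          · obtain ⟨x, rfl⟩ := cycleMk_surjective e q
            simp [hG, hF] }
    rw [Nat.card_congr E, Finite.card_option, if_pos hp]
  · obtain ⟨F, hF⟩ := exists_cycles_lift (σ := σ)
      (f := Fin.cases (motive := fun _ => Cycles e) (cycleMk e y) (fun x => cycleMk e x))
      (by
        intro x
        refine Fin.cases ?_ (fun x => ?_) x
        · rw [h0, hp]; simp
        · rw [hsucc, hp]
          rcases eq_or_ne (e x) y with h | h
          · rw [h, Equiv.swap_apply_right]; simp [← h, cycleMk_apply]
          · rw [Equiv.swap_apply_of_ne_of_ne (Fin.succ_ne_zero _)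
              (fun h' => h (Fin.succ_injective _ h'))]
            simp [cycleMk_apply])
    let E : Cycles σ ≃ Cycles e :=
      { toFun := F
        invFun := G
        left_inv := by
          intro q
          obtain ⟨x, rfl⟩ := cycleMk_surjective σ q
          rw [hF]
          refine Fin.cases ?_ (fun x => ?_) x
          · simp [hG, ← hp, ← h0, cycleMk_apply]
          · simp [hG]
        right_inv := by
          intro q
          obtain ⟨x, rfl⟩ := cycleMk_surjective e q
          simp [hG, hF] }
    rw [Nat.card_congr E, if_neg (by rw [hp]; exact Fin.succ_ne_zero _), add_zero]

lemma sum_pow_cycleCount (θ : ℝ) (N : ℕ) :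
    ∑ σ : Equiv.Perm (Fin N), θ ^ cycleCount σ = ∏ k ∈ Finset.range N, (θ + (k : ℝ)) := by
  induction N with
  | zero => simp [cycleCount]
  | succ n ih =>
    rw [Finset.prod_range_succ, ← ih, ← Equiv.sum_comp Equiv.Perm.decomposeFin.symm,
      Fintype.sum_prod_type, Fin.sum_univ_succ]
    simp only [cycleCount_eq_card_cycles, card_cycles_decomposeFin_symm, if_true,
      Fin.succ_ne_zero, if_false, add_zero, Finset.sum_const, Finset.card_univ, Fintype.card_fin,
      nsmul_eq_mul, pow_succ, ← Finset.sum_mul]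
    ring

lemma cycleCount_conj {N : ℕ} (σ τ : Equiv.Perm (Fin N)) :
    cycleCount (τ * σ * τ⁻¹) = cycleCount σ := by
  simp [cycleCount, Equiv.Perm.cycleType_conj]

lemma pow_cycleCount_le {N : ℕ} {θ : ℝ} (hθ : 0 < θ) (σ : Equiv.Perm (Fin N)) (b c : Fin N) :
    θ ^ cycleCount σ ≤ (1 + θ + θ⁻¹) * θ ^ cycleCount (Equiv.swap b c * σ) := by
  have h1 := card_cycles_le_card_cycles_swap_mul σ b c
  have h2 := card_cycles_le_card_cycles_swap_mul (Equiv.swap b c * σ) b c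
  rw [← mul_assoc, Equiv.swap_mul_self, one_mul] at h2
  rw [← cycleCount_eq_card_cycles, ← cycleCount_eq_card_cycles] at h1 h2
  set m := cycleCount (Equiv.swap b c * σ)
  have hi : 0 < θ⁻¹ := inv_pos.2 hθ
  have : cycleCount σ = m + 1 ∨ cycleCount σ = m ∨ cycleCount σ + 1 = m := by omega
  rcases this with h | h | h
  · rw [h, pow_succ, mul_comm]
    gcongr
    linarith
  · rw [h]
    exact le_mul_of_one_le_left (by positivity) (by linarith)
  · rw [← h, pow_succ]
    have : θ⁻¹ * (θ ^ cycleCount σ * θ) = θ ^ cycleCount σ := by field_simp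
    nlinarith [pow_pos hθ (cycleCount σ), mul_pos (pow_pos hθ (cycleCount σ)) hθ,
      mul_pos (mul_pos (pow_pos hθ (cycleCount σ)) hθ) hθ]

/-- Total weight of the permutations satisfying `F`. -/
def mass {N : ℕ} (w : Equiv.Perm (Fin N) → ℝ) (F : Equiv.Perm (Fin N) → Prop) : ℝ :=
  ∑ σ, if F σ then w σ else 0

/-- A conjugation-invariant weight which changes by a factor at most `K` under left
multiplication by a transposition. -/
structure IsQuasiUniform {N : ℕ} (K : ℝ) (w : Equiv.Perm (Fin N) → ℝ) : Prop where
  nonneg : ∀ σ, 0 ≤ w σ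
  conj : ∀ σ b c, w (Equiv.swap b c * σ * Equiv.swap b c) = w σ
  le_swap : ∀ σ b c, w σ ≤ K * w (Equiv.swap b c * σ)

/-- `f σ` only depends on the restriction of `σ` to `U`. -/
def DeterminedBy {N : ℕ} {α : Type*} (U : Finset (Fin N)) (f : Equiv.Perm (Fin N) → α) : Prop :=
  ∀ σ σ' : Equiv.Perm (Fin N), (∀ u ∈ U, σ u = σ' u) → f σ = f σ'

section Mass

variable {N : ℕ} {K : ℝ} {w : Equiv.Perm (Fin N) → ℝ}

lemma mass_eq_sum_filter (w : Equiv.Perm (Fin N) → ℝ) (F : Equiv.Perm (Fin N) → Prop) :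
    mass w F = ∑ σ ∈ univ.filter F, w σ := by
  rw [mass, Finset.sum_filter]

lemma mass_nonneg (hw : ∀ σ, 0 ≤ w σ) (F : Equiv.Perm (Fin N) → Prop) : 0 ≤ mass w F :=
  Finset.sum_nonneg fun σ _ => by split_ifs <;> simp [hw]

lemma mass_mono (hw : ∀ σ, 0 ≤ w σ) {F G : Equiv.Perm (Fin N) → Prop} (h : ∀ σ, F σ → G σ) :
    mass w F ≤ mass w G := by
  refine Finset.sum_le_sum fun σ _ => ?_
  by_cases hF : F σ
  · simp [hF, h σ hF]
  · simp only [hF, if_false]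
    split_ifs <;> simp [hw]

lemma mass_le_add (hw : ∀ σ, 0 ≤ w σ) {F G H : Equiv.Perm (Fin N) → Prop}
    (h : ∀ σ, F σ → G σ ∨ H σ) : mass w F ≤ mass w G + mass w H := by
  rw [mass, mass, mass, ← Finset.sum_add_distrib]
  refine Finset.sum_le_sum fun σ _ => ?_
  have := h σ
  by_cases hF : F σ <;> by_cases hG : G σ <;> by_cases hH : H σ <;>
    simp_all

lemma mass_and_add_mass_and_not (w : Equiv.Perm (Fin N) → ℝ) (F G : Equiv.Perm (Fin N) → Prop) :
    mass w (fun σ => F σ ∧ G σ) + mass w (fun σ => F σ ∧ ¬ G σ) = mass w F := by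
  rw [mass, mass, mass, ← Finset.sum_add_distrib]
  refine Finset.sum_congr rfl fun σ _ => ?_
  by_cases hF : F σ <;> by_cases hG : G σ <;> simp [hF, hG]

lemma mass_le_sum {ι : Type*} (hw : ∀ σ, 0 ≤ w σ) {F : Equiv.Perm (Fin N) → Prop} (B : Finset ι)
    {G : ι → Equiv.Perm (Fin N) → Prop} (h : ∀ σ, F σ → ∃ b ∈ B, G b σ) :
    mass w F ≤ ∑ b ∈ B, mass w (G b) := by
  simp only [mass]
  rw [Finset.sum_comm]
  refine Finset.sum_le_sum fun σ _ => ?_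
  have h0 : ∀ b ∈ B, 0 ≤ if G b σ then w σ else 0 := fun b _ => by split_ifs <;> simp [hw]
  by_cases hF : F σ
  · obtain ⟨b, hb, hG⟩ := h σ hF
    simp only [hF, if_true]
    calc w σ = if G b σ then w σ else 0 := by simp [hG]
      _ ≤ _ := Finset.single_le_sum h0 hb
  · simp only [hF, if_false]
    exact Finset.sum_nonneg h0

/-- A new value is attained with conditional probability at most `K / (N - #U)`. -/
lemma IsQuasiUniform.mass_apply_eq_le (hw : IsQuasiUniform K w) {U : Finset (Fin N)} {a : Fin N}
    (ha : a ∉ U) {F : Equiv.Perm (Fin N) → Prop} (hF : DeterminedBy U F)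
    {g : Equiv.Perm (Fin N) → Fin N} (hg : DeterminedBy U g) :
    ((N : ℝ) - U.card) * mass w (fun σ => F σ ∧ σ a = g σ) ≤ K * mass w F := by
  set S := univ.filter (fun σ : Equiv.Perm (Fin N) => F σ ∧ σ a = g σ) with hS
  set P : Finset ((_ : Equiv.Perm (Fin N)) × Fin N) := S.sigma fun σ => univ \ U.image σ with hP
  set φ : ((_ : Equiv.Perm (Fin N)) × Fin N) → Equiv.Perm (Fin N) :=
    fun p => Equiv.swap (g p.1) p.2 * p.1 with hφ
  have key : ∀ p ∈ P, (∀ u ∈ U, φ p u = p.1 u) ∧ φ p a = p.2 ∧ F p.1 := by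
    rintro ⟨σ, b⟩ hp
    simp only [hP, hS, Finset.mem_sigma, mem_filter, mem_univ, true_and, mem_sdiff,
      Finset.mem_image, not_exists, not_and] at hp
    obtain ⟨⟨h1, h2⟩, h3⟩ := hp
    refine ⟨fun u hu => ?_, ?_, h1⟩
    · simp only [hφ, Equiv.Perm.mul_apply]
      refine Equiv.swap_apply_of_ne_of_ne ?_ (h3 u hu)
      rw [← h2]
      exact fun h => ha (σ.injective h ▸ hu)
    · simp only [hφ, Equiv.Perm.mul_apply, h2, Equiv.swap_apply_left]
  have hinj : Set.InjOn φ P := by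
    rintro ⟨σ, b⟩ hp ⟨σ', b'⟩ hp' h
    obtain ⟨h1, h2, -⟩ := key _ hp
    obtain ⟨h1', h2', -⟩ := key _ hp'
    have hb : b = b' := h2.symm.trans ((congrArg (fun τ => τ a) h).trans h2')
    have hgg : g σ = g σ' := hg _ _ fun u hu =>
      (h1 u hu).symm.trans ((congrArg (fun τ => τ u) h).trans (h1' u hu))
    simp only [hφ, hgg, hb] at h
    rw [mul_left_cancel h, hb]
  have hcard : ∀ σ : Equiv.Perm (Fin N),
      (((univ \ U.image σ).card : ℕ) : ℝ) = (N : ℝ) - U.card := by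
    intro σ
    rw [Finset.card_sdiff_of_subset (Finset.subset_univ _),
      Finset.card_image_of_injective _ σ.injective,
      Nat.cast_sub (Finset.card_le_card (Finset.subset_univ _))]
    simp
  calc ((N : ℝ) - U.card) * mass w (fun σ => F σ ∧ σ a = g σ)
      = ∑ p ∈ P, w p.1 := by
        rw [Finset.sum_sigma, mass_eq_sum_filter, Finset.mul_sum]
        refine Finset.sum_congr (by ext; simp [hS]) fun σ _ => ?_
        simp only [Finset.sum_const, nsmul_eq_mul, hcard]
    _ ≤ ∑ p ∈ P, K * w (φ p) := Finset.sum_le_sum fun p _ => hw.le_swap _ _ _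
    _ = K * ∑ σ ∈ P.image φ, w σ := by rw [Finset.sum_image hinj, Finset.mul_sum]
    _ ≤ K * mass w F := by
        have hK : 0 ≤ K ∨ ∀ σ, w σ = 0 := by
          by_contra! h
          obtain ⟨h1, σ, h2⟩ := h
          have h3 := hw.le_swap σ a a
          have h4 := lt_of_le_of_ne (hw.nonneg σ) h2.symm
          simp only [Equiv.swap_self] at h3
          change w σ ≤ K * w σ at h3
          nlinarith
        rcases hK with hK | hK
        · refine mul_le_mul_of_nonneg_left ?_ hK
          rw [mass_eq_sum_filter]
          refine Finset.sum_le_sum_of_subset_of_nonneg ?_ fun σ _ _ => hw.nonneg σ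
          intro σ hσ
          obtain ⟨p, hp, rfl⟩ := Finset.mem_image.1 hσ
          obtain ⟨h1, -, h3⟩ := key p hp
          simp only [mem_filter, mem_univ, true_and]
          rwa [hF _ _ h1]
        · simp [mass, hK]

/-- The values outside `U ∪ {a}` and the image of `U`. -/
def freshValues (U : Finset (Fin N)) (a : Fin N) (σ : Equiv.Perm (Fin N)) : Finset (Fin N) :=
  univ \ (insert a U ∪ U.image σ)

lemma mem_freshValues {U : Finset (Fin N)} {a b : Fin N} {σ : Equiv.Perm (Fin N)} :
    b ∈ freshValues U a σ ↔ b ≠ a ∧ b ∉ U ∧ ∀ u ∈ U, σ u ≠ b := by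
  simp [freshValues, not_or]

/-- All fresh values are equally likely. -/
lemma IsQuasiUniform.sum_card_freshValues (hw : IsQuasiUniform K w) {U : Finset (Fin N)}
    {a : Fin N} {F : Equiv.Perm (Fin N) → Prop} (hF : DeterminedBy U F)
    {g : Equiv.Perm (Fin N) → Fin N} (hg : DeterminedBy U g)
    (hfresh : ∀ σ, F σ → g σ ∈ freshValues U a σ) :
    ∑ σ ∈ univ.filter (fun σ => F σ ∧ σ a = g σ), ((freshValues U a σ).card : ℝ) * w σ =
      mass w (fun σ => F σ ∧ σ a ∈ freshValues U a σ) := by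
  have hconj : ∀ (σ : Equiv.Perm (Fin N)) (b c : Fin N), F σ → b ∈ freshValues U a σ →
      c ∈ freshValues U a σ → (∀ u ∈ U, (Equiv.swap b c * σ * Equiv.swap b c) u = σ u) ∧
      (Equiv.swap b c * σ * Equiv.swap b c) a = Equiv.swap b c (σ a) := by
    intro σ b c _ hb hc
    rw [mem_freshValues] at hb hc
    constructor
    · intro u hu
      simp only [Equiv.Perm.mul_apply]
      rw [Equiv.swap_apply_of_ne_of_ne (fun h : u = b => hb.2.1 (h ▸ hu))
        (fun h : u = c => hc.2.1 (h ▸ hu)),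
        Equiv.swap_apply_of_ne_of_ne (hb.2.2 u hu) (hc.2.2 u hu)]
    · simp only [Equiv.Perm.mul_apply]
      rw [Equiv.swap_apply_of_ne_of_ne hb.1.symm hc.1.symm]
  have hfr : ∀ σ σ' : Equiv.Perm (Fin N), (∀ u ∈ U, σ u = σ' u) →
      freshValues U a σ = freshValues U a σ' := by
    intro σ σ' h
    ext b
    simp only [mem_freshValues]
    refine and_congr_right fun _ => and_congr_right fun _ => forall₂_congr fun u hu => ?_
    rw [h u hu]
  have hinv : ∀ (σ : Equiv.Perm (Fin N)) (b c : Fin N),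
      Equiv.swap b c * (Equiv.swap b c * σ * Equiv.swap b c) * Equiv.swap b c = σ := by
    intro σ b c
    rw [mul_assoc, mul_assoc, Equiv.swap_mul_self, mul_one, ← mul_assoc, Equiv.swap_mul_self,
      one_mul]
  rw [mass_eq_sum_filter]
  simp_rw [← nsmul_eq_mul, ← Finset.sum_const]
  rw [← Finset.sum_sigma (univ.filter fun σ => F σ ∧ σ a = g σ) (fun σ => freshValues U a σ)
    (fun p => w p.1)]
  refine Finset.sum_bij' (fun p _ => Equiv.swap (g p.1) p.2 * p.1 * Equiv.swap (g p.1) p.2)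
    (fun σ _ => ⟨Equiv.swap (g σ) (σ a) * σ * Equiv.swap (g σ) (σ a), σ a⟩) ?_ ?_ ?_ ?_ ?_
  · rintro ⟨σ, b⟩ hp
    simp only [Finset.mem_sigma, mem_filter, mem_univ, true_and] at hp ⊢
    obtain ⟨⟨h1, h2⟩, h3⟩ := hp
    obtain ⟨h4, h5⟩ := hconj σ _ b h1 (hfresh σ h1) h3
    rw [h5, h2, Equiv.swap_apply_left, hfr _ _ h4, hF _ _ h4]
    exact ⟨h1, h3⟩
  · intro σ hσ
    simp only [Finset.mem_sigma, mem_filter, mem_univ, true_and] at hσ ⊢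
    obtain ⟨h1, h3⟩ := hσ
    obtain ⟨h4, h5⟩ := hconj σ _ (σ a) h1 (hfresh σ h1) h3
    rw [h5, Equiv.swap_apply_right, hfr _ _ h4, hF _ _ h4, hg _ _ h4]
    exact ⟨⟨h1, rfl⟩, h3⟩
  · rintro ⟨σ, b⟩ hp
    simp only [Finset.mem_sigma, mem_filter, mem_univ, true_and] at hp
    obtain ⟨⟨h1, h2⟩, h3⟩ := hp
    obtain ⟨h4, h5⟩ := hconj σ _ b h1 (hfresh σ h1) h3
    simp only [h5, h2, Equiv.swap_apply_left, hg _ _ h4, hinv]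
  · intro σ hσ
    simp only [mem_filter, mem_univ, true_and] at hσ
    obtain ⟨h1, h3⟩ := hσ
    obtain ⟨h4, h5⟩ := hconj σ _ (σ a) h1 (hfresh σ h1) h3
    simp only [hg _ _ h4, hinv]
  · rintro ⟨σ, b⟩ _
    exact (hw.conj _ _ _).symm

lemma IsQuasiUniform.mass_apply_eq_le_two_mul (hw : IsQuasiUniform K w)
    {U : Finset (Fin N)} (hU : 2 * U.card ≤ N) {a : Fin N} (ha : a ∉ U)
    {F : Equiv.Perm (Fin N) → Prop} (hF : DeterminedBy U F)
    {g : Equiv.Perm (Fin N) → Fin N} (hg : DeterminedBy U g) :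
    mass w (fun σ => F σ ∧ σ a = g σ) ≤ 2 * K / N * mass w F := by
  have h := hw.mass_apply_eq_le ha hF hg
  have hN : (0 : ℝ) < N := by exact_mod_cast a.pos
  have hU' : (2 : ℝ) * U.card ≤ N := by exact_mod_cast hU
  have h0 := mass_nonneg hw.nonneg (fun σ => F σ ∧ σ a = g σ)
  rw [div_mul_eq_mul_div, le_div_iff₀ hN]
  nlinarith

lemma IsQuasiUniform.mul_mass_apply_eq_fresh_le (hw : IsQuasiUniform K w)
    {U : Finset (Fin N)} {a : Fin N} {F : Equiv.Perm (Fin N) → Prop} (hF : DeterminedBy U F)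
    {g : Equiv.Perm (Fin N) → Fin N} (hg : DeterminedBy U g)
    (hfresh : ∀ σ, F σ → g σ ∈ freshValues U a σ) :
    ((N : ℝ) - (2 * U.card + 1)) * mass w (fun σ => F σ ∧ σ a = g σ) ≤ mass w F := by
  refine le_trans ?_ ((hw.sum_card_freshValues hF hg hfresh).trans_le
    (mass_mono hw.nonneg fun σ h => h.1))
  rw [mass_eq_sum_filter, Finset.mul_sum]
  refine (Finset.sum_congr (by ext; simp) fun _ _ => rfl).trans_le
    (Finset.sum_le_sum fun σ _ => mul_le_mul_of_nonneg_right ?_ (hw.nonneg σ))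
  have h1 : N ≤ (freshValues U a σ).card + (2 * U.card + 1) := by
    have h2 : (insert a U ∪ U.image σ).card ≤ 2 * U.card + 1 := by
      refine (Finset.card_union_le _ _).trans ?_
      have := Finset.card_insert_le a U
      have := Finset.card_image_le (s := U) (f := σ)
      omega
    have h3 := Finset.le_card_sdiff (insert a U ∪ U.image σ) univ
    rw [Finset.card_univ, Fintype.card_fin] at h3
    change _ ≤ (freshValues U a σ).card at h3
    omega
  have h2 : (N : ℝ) ≤ (freshValues U a σ).card + (2 * U.card + 1) := by exact_mod_cast h1
  linarith

lemma IsQuasiUniform.le_mul_mass_apply_eq_fresh (hw : IsQuasiUniform K w)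
    {U : Finset (Fin N)} (hU : 2 * U.card ≤ N) {a : Fin N} (ha : a ∉ U)
    {F : Equiv.Perm (Fin N) → Prop} (hF : DeterminedBy U F)
    {g : Equiv.Perm (Fin N) → Fin N} (hg : DeterminedBy U g)
    (hfresh : ∀ σ, F σ → g σ ∈ freshValues U a σ) :
    mass w F - (U.card + 1) * (2 * K / N) * mass w F ≤
      N * mass w (fun σ => F σ ∧ σ a = g σ) := by
  have h1 : mass w (fun σ => F σ ∧ ¬ σ a ∈ freshValues U a σ) ≤
      (U.card + 1) * (2 * K / N) * mass w F := by
    calc _ ≤ ∑ u ∈ insert a U, mass w (fun σ => F σ ∧ σ a = u) := by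
          refine mass_le_sum hw.nonneg _ fun σ hσ => ⟨σ a, ?_, hσ.1, rfl⟩
          by_contra h
          rw [Finset.mem_insert, not_or] at h
          refine hσ.2 (mem_freshValues.2 ⟨h.1, h.2, fun u hu h' => ha (σ.injective h' ▸ hu)⟩)
      _ ≤ ∑ u ∈ insert a U, 2 * K / N * mass w F :=
          Finset.sum_le_sum fun u _ => hw.mass_apply_eq_le_two_mul hU ha hF fun _ _ _ => rfl
      _ = _ := by
          rw [Finset.sum_const, Finset.card_insert_of_notMem ha, nsmul_eq_mul]
          push_cast
          ring
  have h2 := mass_and_add_mass_and_not w F (fun σ => σ a ∈ freshValues U a σ)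
  rw [← hw.sum_card_freshValues hF hg hfresh] at h2
  have h3 : ∑ σ ∈ univ.filter (fun σ => F σ ∧ σ a = g σ), ((freshValues U a σ).card : ℝ) * w σ ≤
      N * mass w (fun σ => F σ ∧ σ a = g σ) := by
    rw [mass_eq_sum_filter, Finset.mul_sum]
    refine (Finset.sum_le_sum fun σ _ => mul_le_mul_of_nonneg_right ?_ (hw.nonneg σ)).trans_eq
      (Finset.sum_congr (by ext; simp) fun _ _ => rfl)
    have := Finset.card_le_univ (freshValues U a σ)
    rw [Fintype.card_fin] at this
    exact_mod_cast this
  linarith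

/-- The constant in `IsQuasiUniform.abs_mass_apply_eq_perm_apply`. -/
def shiftConst (K : ℝ) (m : ℕ) : ℝ :=
  2 * (2 * m + 3) + 4 * K ^ 2 * (2 * m + 3) + 2 * K * (3 * m + 5)

/-- Conditionally on an event depending on few values, `σ a = f (σ i)` has probability `1 / N`
up to a relative error of order `1 / N`. -/
lemma IsQuasiUniform.abs_mass_apply_eq_perm_apply (hw : IsQuasiUniform K w) (hK : 0 ≤ K) {m : ℕ}
    (hN : 4 * m + 8 ≤ N) {U : Finset (Fin N)} (hU : U.card ≤ m) {i a : Fin N} (hi : i ∉ U)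
    (ha : a ∉ U) (hia : i ≠ a) {D : Equiv.Perm (Fin N) → Prop} (hD : DeterminedBy U D)
    {f : Equiv.Perm (Fin N)} (hf : ∀ v, f v ≠ v) {B : Finset (Fin N)} (hB : B.card ≤ 1) :
    |N * mass w (fun σ => D σ ∧ σ i ∉ B ∧ σ a = f (σ i)) - mass w D| ≤
      shiftConst K m / N * mass w D := by
  have hN0 : (0 : ℝ) < N := by exact_mod_cast i.pos
  set G : Equiv.Perm (Fin N) → Prop :=
    fun σ => σ i ∉ B ∧ f (σ i) ∈ freshValues (insert i U) a σ with hG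
  have hU2 : (insert i U).card ≤ m + 1 := by rw [Finset.card_insert_of_notMem hi]; omega
  have ha2 : a ∉ insert i U := by simp [ha, hia.symm]
  have hD2 : DeterminedBy (insert i U) D :=
    fun σ σ' h => hD _ _ fun u hu => h u (Finset.mem_insert_of_mem hu)
  have hg : DeterminedBy (insert i U) (fun σ => f (σ i)) :=
    fun σ σ' h => congrArg f (h i (Finset.mem_insert_self _ _))
  have hGd : DeterminedBy (insert i U) G := by
    intro σ σ' h
    have h1 := h i (Finset.mem_insert_self _ _)
    have h2 : freshValues (insert i U) a σ = freshValues (insert i U) a σ' := by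
      rw [freshValues, freshValues, Finset.image_congr (fun u hu => h u hu)]
    simp only [hG, h1, h2]
  have hDG : DeterminedBy (insert i U) (fun σ => D σ ∧ G σ) :=
    fun σ σ' h => by simp only [hD2 _ _ h, hGd _ _ h]
  have hDnG : DeterminedBy (insert i U) (fun σ => D σ ∧ ¬ G σ) :=
    fun σ σ' h => by simp only [hD2 _ _ h, hGd _ _ h]
  have hxy := mass_and_add_mass_and_not w D G
  have hbad : mass w (fun σ => D σ ∧ ¬ G σ) ≤ (2 * m + 3) * (2 * K / N) * mass w D := by
    set C := B ∪ (insert a (insert i U)).image f.symm with hC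
    have hCcard : C.card ≤ m + 3 := by
      refine (Finset.card_union_le _ _).trans ?_
      have := Finset.card_insert_le a (insert i U)
      have := Finset.card_image_le (s := insert a (insert i U)) (f := f.symm)
      omega
    have h1 : mass w (fun σ => D σ ∧ ¬ G σ) ≤ mass w (fun σ => D σ ∧ σ i ∈ C) +
        mass w (fun σ => D σ ∧ ∃ u ∈ U, σ i = f.symm (σ u)) := by
      refine mass_le_add hw.nonneg fun σ hσ => ?_
      obtain ⟨h1, h2⟩ := hσ
      by_contra! h
      obtain ⟨h3, h4⟩ := h
      have h3 := h3 h1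
      have h4 := h4 h1
      rw [hC, Finset.mem_union, not_or] at h3
      have h5 : f (σ i) ∉ insert a (insert i U) := fun h =>
        h3.2 (Finset.mem_image.2 ⟨_, h, by simp⟩)
      rw [Finset.mem_insert, not_or] at h5
      refine h2 ⟨h3.1, mem_freshValues.2 ⟨h5.1, h5.2, fun u hu => ?_⟩⟩
      rcases Finset.mem_insert.1 hu with rfl | hu
      · exact (hf _).symm
      · intro h
        exact h4 u hu (by rw [h]; simp)
    have hpos : 0 ≤ 2 * K / N * mass w D := by
      have := mass_nonneg hw.nonneg D
      positivity
    have h2 : mass w (fun σ => D σ ∧ σ i ∈ C) ≤ (m + 3) * (2 * K / N * mass w D) := by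
      calc _ ≤ ∑ v ∈ C, mass w (fun σ => D σ ∧ σ i = v) :=
            mass_le_sum hw.nonneg _ fun σ hσ => ⟨σ i, hσ.2, hσ.1, rfl⟩
        _ ≤ ∑ v ∈ C, 2 * K / N * mass w D := Finset.sum_le_sum fun v _ =>
            hw.mass_apply_eq_le_two_mul (by omega) hi hD fun _ _ _ => rfl
        _ = C.card * (2 * K / N * mass w D) := by rw [Finset.sum_const, nsmul_eq_mul]
        _ ≤ _ := mul_le_mul_of_nonneg_right (by exact_mod_cast hCcard) hpos
    have h3 : mass w (fun σ => D σ ∧ ∃ u ∈ U, σ i = f.symm (σ u)) ≤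
        m * (2 * K / N * mass w D) := by
      calc _ ≤ ∑ u ∈ U, mass w (fun σ => D σ ∧ σ i = f.symm (σ u)) :=
            mass_le_sum hw.nonneg _ fun σ hσ => by
              obtain ⟨h1, u, hu, h2⟩ := hσ
              exact ⟨u, hu, h1, h2⟩
        _ ≤ ∑ u ∈ U, 2 * K / N * mass w D := Finset.sum_le_sum fun u hu =>
            hw.mass_apply_eq_le_two_mul (by omega) hi hD
              fun σ σ' h => congrArg f.symm (h u hu)
        _ = U.card * (2 * K / N * mass w D) := by rw [Finset.sum_const, nsmul_eq_mul]
        _ ≤ _ := mul_le_mul_of_nonneg_right (by exact_mod_cast hU) hpos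
    linarith
  have hfresh : ∀ σ, D σ ∧ G σ → f (σ i) ∈ freshValues (insert i U) a σ := fun σ h => h.2.2
  have hz1 := hw.mul_mass_apply_eq_fresh_le hDG hg hfresh
  have hz2 := hw.le_mul_mass_apply_eq_fresh (by omega) ha2 hDG hg hfresh
  have hv := hw.mass_apply_eq_le_two_mul (by omega) ha2 hDnG hg
  have hT1 : mass w (fun σ => D σ ∧ σ i ∉ B ∧ σ a = f (σ i)) ≤
      mass w (fun σ => (D σ ∧ G σ) ∧ σ a = f (σ i)) +
      mass w (fun σ => (D σ ∧ ¬ G σ) ∧ σ a = f (σ i)) := by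
    refine mass_le_add hw.nonneg fun σ hσ => ?_
    tauto
  have hT2 : mass w (fun σ => (D σ ∧ G σ) ∧ σ a = f (σ i)) ≤
      mass w (fun σ => D σ ∧ σ i ∉ B ∧ σ a = f (σ i)) :=
    mass_mono hw.nonneg fun σ h => ⟨h.1.1, h.1.2.1, h.2⟩
  have hx0 := mass_nonneg hw.nonneg D
  have hy0 := mass_nonneg hw.nonneg (fun σ => D σ ∧ G σ)
  have hz0 := mass_nonneg hw.nonneg (fun σ => (D σ ∧ G σ) ∧ σ a = f (σ i))
  have hu0 := mass_nonneg hw.nonneg (fun σ => D σ ∧ ¬ G σ)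
  set x := mass w D
  set y := mass w (fun σ => D σ ∧ G σ)
  set z := mass w (fun σ => (D σ ∧ G σ) ∧ σ a = f (σ i))
  set v := mass w (fun σ => (D σ ∧ ¬ G σ) ∧ σ a = f (σ i))
  set T := mass w (fun σ => D σ ∧ σ i ∉ B ∧ σ a = f (σ i))
  set u := mass w (fun σ => D σ ∧ ¬ G σ)
  have hc : ((insert i U).card : ℝ) ≤ m + 1 := by exact_mod_cast hU2
  have hNm : (4 : ℝ) * m + 8 ≤ N := by exact_mod_cast hN
  have hyx : y ≤ x := by linarith
  have hz3 : z ≤ 2 / N * x := by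
    rw [div_mul_eq_mul_div, le_div_iff₀ hN0]
    nlinarith
  have hz4 : N * z ≤ x + (2 * m + 3) * (2 / N * x) := by
    have : (2 * m + 3) * z ≤ (2 * m + 3) * (2 / N * x) := by gcongr
    nlinarith
  have hv2 : N * v ≤ 2 * K * ((2 * m + 3) * (2 * K / N) * x) := by
    calc N * v ≤ N * (2 * K / N * u) := by gcongr
      _ = 2 * K * u := by field_simp
      _ ≤ _ := by gcongr
  have hz5 : x - (2 * m + 3) * (2 * K / N) * x - (m + 2) * (2 * K / N) * x ≤ N * z := by
    have : ((insert i U).card + 1) * (2 * K / N) * y ≤ (m + 2) * (2 * K / N) * x := by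
      have : ((insert i U).card : ℝ) + 1 ≤ m + 2 := by linarith
      gcongr
    linarith
  have hTu : N * T ≤ N * z + N * v := by
    rw [← mul_add]; gcongr
  have hTl : N * z ≤ N * T := by gcongr
  have e1 : (2 * m + 3) * (2 / N * x) + 2 * K * ((2 * m + 3) * (2 * K / N) * x) =
      (2 * (2 * m + 3) + 4 * K ^ 2 * (2 * m + 3)) / N * x := by field_simp; ring
  have e2 : (2 * m + 3) * (2 * K / N) * x + (m + 2) * (2 * K / N) * x =
      (2 * K * (3 * m + 5)) / N * x := by field_simp; ring
  have e3 : shiftConst K m / N * x = (2 * (2 * m + 3) + 4 * K ^ 2 * (2 * m + 3)) / N * x +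
      (2 * K * (3 * m + 5)) / N * x := by rw [shiftConst]; ring
  have p1 : 0 ≤ (2 * (2 * m + 3) + 4 * K ^ 2 * (2 * m + 3)) / N * x := by positivity
  have p2 : 0 ≤ (2 * K * (3 * m + 5)) / N * x := by positivity
  rw [abs_le, e3]
  constructor <;> linarith

lemma mass_eq_add_of_disjoint {F G H : Equiv.Perm (Fin N) → Prop} (w : Equiv.Perm (Fin N) → ℝ)
    (h : ∀ σ, F σ ↔ G σ ∨ H σ) (hGH : ∀ σ, G σ → ¬ H σ) : mass w F = mass w G + mass w H := by
  rw [mass, mass, mass, ← Finset.sum_add_distrib]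
  refine Finset.sum_congr rfl fun σ _ => ?_
  have := h σ
  have := hGH σ
  by_cases hG : G σ <;> by_cases hH : H σ <;> simp_all

/-- `σ` has an adjacency at position `i`. -/
def AdjAt (σ : Equiv.Perm (Fin N)) (i : Fin N) : Prop :=
  ∃ i' : Fin N, (i' : ℕ) = (i : ℕ) + 1 ∧
    ((σ i' : ℕ) = (σ i : ℕ) + 1 ∨ (σ i' : ℕ) + 1 = (σ i : ℕ))

lemma adjCount_eq_card (σ : Equiv.Perm (Fin N)) :
    adjCount σ = (univ.filter (AdjAt σ)).card := by
  rw [adjCount]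
  congr 1
  ext
  simp [AdjAt]

lemma val_finRotate {i : Fin N} (h : (i : ℕ) + 1 < N) : (finRotate N i : ℕ) = i + 1 := by
  obtain ⟨n, rfl⟩ := Nat.exists_eq_succ_of_ne_zero (by omega : N ≠ 0)
  refine coe_finRotate_of_ne_last fun h' => ?_
  rw [h'] at h
  simp at h

lemma eq_finRotate_iff {i j : Fin N} (h : (i : ℕ) + 1 < N) :
    j = finRotate N i ↔ (j : ℕ) = i + 1 := by
  rw [Fin.ext_iff, val_finRotate h]

lemma finRotate_ne_self (hN : 2 ≤ N) (v : Fin N) : finRotate N v ≠ v := by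
  have h := support_finRotate_of_le hN
  have : v ∈ (finRotate N).support := by rw [h]; exact mem_univ v
  simpa using this

lemma adjAt_iff (σ : Equiv.Perm (Fin N)) {i : Fin N} (hi : (i : ℕ) + 1 < N) :
    AdjAt σ i ↔
      (σ i ∉ univ.filter (fun v : Fin N => (v : ℕ) + 1 = N) ∧
        σ (finRotate N i) = finRotate N (σ i)) ∨
      (σ i ∉ univ.filter (fun v : Fin N => (v : ℕ) = 0) ∧
        σ (finRotate N i) = (finRotate N).symm (σ i)) := by
  simp only [mem_filter, mem_univ, true_and]
  have h1 : AdjAt σ i ↔ (σ (finRotate N i) : ℕ) = σ i + 1 ∨ (σ (finRotate N i) : ℕ) + 1 = σ i := by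
    constructor
    · rintro ⟨i', h, h'⟩
      rw [← eq_finRotate_iff hi] at h
      rwa [← h]
    · exact fun h => ⟨_, val_finRotate hi, h⟩
  rw [h1]
  refine or_congr ?_ ?_
  · constructor
    · intro h
      have := (σ (finRotate N i)).isLt
      exact ⟨by omega, (eq_finRotate_iff (by omega)).2 h⟩
    · rintro ⟨h, h'⟩
      have := (σ i).isLt
      exact (eq_finRotate_iff (by omega)).1 h'
  · rw [Equiv.eq_symm_apply]
    constructor
    · intro h
      have := (σ i).isLt
      exact ⟨by omega, ((eq_finRotate_iff (by omega)).2 h.symm).symm⟩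
    · rintro ⟨h, h'⟩
      have h2 : (σ (finRotate N i) : ℕ) + 1 < N := by
        by_contra h3
        obtain ⟨n, rfl⟩ := Nat.exists_eq_succ_of_ne_zero (by omega : N ≠ 0)
        have h4 : σ (finRotate _ i) = Fin.last n := by
          ext
          have := (σ (finRotate _ i)).isLt
          simp only [Fin.val_last]
          omega
        rw [h4, finRotate_last] at h'
        exact h (by rw [← h']; rfl)
      exact ((eq_finRotate_iff h2).1 h'.symm).symm

lemma AdjAt.lt {σ : Equiv.Perm (Fin N)} {i : Fin N} (h : AdjAt σ i) : (i : ℕ) + 1 < N := by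
  obtain ⟨i', h, -⟩ := h
  exact h ▸ i'.isLt

/-- The positions involved in adjacencies at the elements of `I`. -/
def adjPositions (I : Finset (Fin N)) : Finset (Fin N) := I ∪ I.image (finRotate N)

lemma card_adjPositions_le (I : Finset (Fin N)) : (adjPositions I).card ≤ 2 * I.card := by
  refine (Finset.card_union_le _ _).trans ?_
  have := Finset.card_image_le (s := I) (f := finRotate N)
  omega

lemma determinedBy_adjAt (I : Finset (Fin N)) :
    DeterminedBy (adjPositions I) (fun σ => ∀ j ∈ I, AdjAt σ j) := by
  intro σ σ' h
  refine propext (forall₂_congr fun j hj => ?_)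
  refine exists_congr fun i' => and_congr_right fun hi' => ?_
  have h1 : i' = finRotate N j := (eq_finRotate_iff (hi' ▸ i'.isLt)).2 hi'
  rw [h j (Finset.mem_union_left _ hj), h i'
    (Finset.mem_union_right _ (Finset.mem_image.2 ⟨j, hj, h1.symm⟩))]

lemma IsQuasiUniform.mass_adjAt_le (hw : IsQuasiUniform K w) (hK : 0 ≤ K)
    (I : Finset (Fin N)) (hI : 4 * I.card ≤ N) :
    mass w (fun σ => ∀ j ∈ I, AdjAt σ j) ≤ (4 * K / N) ^ I.card * mass w (fun _ => True) := by
  induction I using Finset.induction_on_max with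
  | empty => simp
  | insert i I hmax ih =>
    have hiI : i ∉ I := fun h => lt_irrefl _ (hmax i h)
    rw [Finset.card_insert_of_notMem hiI] at hI ⊢
    have ih := ih (by omega)
    have h0 : 0 ≤ mass w (fun _ => True) := mass_nonneg hw.nonneg _
    by_cases hi : (i : ℕ) + 1 < N
    · set U := insert i (adjPositions I) with hU
      have hUc : U.card ≤ 2 * I.card + 1 :=
        (Finset.card_insert_le _ _).trans (by have := card_adjPositions_le I; omega)
      have ha : finRotate N i ∉ U := by
        simp only [hU, adjPositions, Finset.mem_insert, Finset.mem_union, Finset.mem_image]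
        rintro (h | h | ⟨j, hj, h⟩)
        · exact finRotate_ne_self (by omega) i h
        · have h1 := hmax _ h
          rw [Fin.lt_def, val_finRotate hi] at h1
          omega
        · exact hiI ((finRotate N).injective h ▸ hj)
      have hD : DeterminedBy U (fun σ => ∀ j ∈ I, AdjAt σ j) :=
        fun σ σ' h => determinedBy_adjAt I σ σ' fun u hu => h u (Finset.mem_insert_of_mem hu)
      have hg : ∀ f : Equiv.Perm (Fin N), DeterminedBy U (fun σ => f (σ i)) :=
        fun f σ σ' h => congrArg f (h i (Finset.mem_insert_self _ _))
      have h1 := hw.mass_apply_eq_le_two_mul (by omega) ha hD (hg (finRotate N))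
      have h2 := hw.mass_apply_eq_le_two_mul (by omega) ha hD (hg (finRotate N).symm)
      have h3 : mass w (fun σ => ∀ j ∈ insert i I, AdjAt σ j) ≤
          mass w (fun σ => (∀ j ∈ I, AdjAt σ j) ∧ σ (finRotate N i) = finRotate N (σ i)) +
          mass w (fun σ => (∀ j ∈ I, AdjAt σ j) ∧
            σ (finRotate N i) = (finRotate N).symm (σ i)) := by
        refine mass_le_add hw.nonneg fun σ hσ => ?_
        have h4 : ∀ j ∈ I, AdjAt σ j := fun j hj => hσ j (Finset.mem_insert_of_mem hj)
        rcases (adjAt_iff σ hi).1 (hσ i (Finset.mem_insert_self _ _)) with h | h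
        · exact Or.inl ⟨h4, h.2⟩
        · exact Or.inr ⟨h4, h.2⟩
      calc _ ≤ 4 * K / N * mass w (fun σ => ∀ j ∈ I, AdjAt σ j) := by
            refine h3.trans ((add_le_add h1 h2).trans_eq ?_)
            ring
        _ ≤ 4 * K / N * ((4 * K / N) ^ I.card * mass w (fun _ => True)) := by gcongr
        _ = _ := by ring
    · have : mass w (fun σ => ∀ j ∈ insert i I, AdjAt σ j) = 0 := by
        rw [mass]
        exact Finset.sum_eq_zero fun σ _ =>
          if_neg fun h => hi (h i (Finset.mem_insert_self _ _)).lt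
      rw [this]
      positivity

lemma IsQuasiUniform.abs_mass_adjAt (hw : IsQuasiUniform K w) (hK : 0 ≤ K)
    {I : Finset (Fin N)} {r : ℕ} (hI : I.card = r) (hN : 8 * r + 8 ≤ N) {i : Fin N}
    (hi : (i : ℕ) + 1 < N) (hiI : i ∉ adjPositions I) (hiI' : finRotate N i ∉ adjPositions I) :
    |N * mass w (fun σ => (∀ j ∈ I, AdjAt σ j) ∧ AdjAt σ i) -
      2 * mass w (fun σ => ∀ j ∈ I, AdjAt σ j)| ≤
      2 * (shiftConst K (2 * r) / N * mass w (fun σ => ∀ j ∈ I, AdjAt σ j)) := by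
  have hrot := finRotate_ne_self (N := N) (by omega)
  have hUc : (adjPositions I).card ≤ 2 * r := hI ▸ card_adjPositions_le I
  have h1 := hw.abs_mass_apply_eq_perm_apply hK (by omega) hUc hiI hiI' (hrot i).symm
    (determinedBy_adjAt I) hrot
    (B := univ.filter (fun v : Fin N => (v : ℕ) + 1 = N)) (by
      refine Finset.card_le_one.2 fun a ha b hb => ?_
      simp only [mem_filter, mem_univ, true_and] at ha hb
      ext
      omega)
  have h2 := hw.abs_mass_apply_eq_perm_apply hK (by omega) hUc hiI hiI' (hrot i).symm
    (determinedBy_adjAt I) (f := (finRotate N).symm)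
    (fun v h => hrot v ((Equiv.symm_apply_eq _).1 h).symm)
    (B := univ.filter (fun v : Fin N => (v : ℕ) = 0)) (by
      refine Finset.card_le_one.2 fun a ha b hb => ?_
      simp only [mem_filter, mem_univ, true_and] at ha hb
      ext
      omega)
  rw [mass_eq_add_of_disjoint w (F := fun σ => (∀ j ∈ I, AdjAt σ j) ∧ AdjAt σ i)
    (fun σ => by rw [adjAt_iff σ hi, and_or_left])
    (fun σ hG hH => by
      obtain ⟨-, hG1, hG2⟩ := hG
      obtain ⟨-, hH1, hH2⟩ := hH
      simp only [mem_filter, mem_univ, true_and] at hG1 hH1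
      have h3 : (σ (finRotate N i) : ℕ) = σ i + 1 :=
        (eq_finRotate_iff (by have := (σ i).isLt; omega)).1 hG2
      have h4 := (Equiv.eq_symm_apply (finRotate N)).1 hH2
      rw [Fin.ext_iff] at h4
      by_cases h5 : (σ (finRotate N i) : ℕ) + 1 < N
      · rw [val_finRotate h5] at h4
        omega
      · obtain ⟨n, rfl⟩ := Nat.exists_eq_succ_of_ne_zero (by omega : N ≠ 0)
        have h6 : σ (finRotate _ i) = Fin.last n := by
          ext
          have := (σ (finRotate _ i)).isLt
          simp only [Fin.val_last]
          omega
        rw [h6, finRotate_last] at h4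
        exact hH1 (by rw [← h4]; rfl))]
  rw [abs_le] at *
  constructor <;> linarith

/-- The `r`-th binomial moment of the number of adjacencies. -/
def adjMoment (w : Equiv.Perm (Fin N) → ℝ) (r : ℕ) : ℝ :=
  ∑ σ, w σ * ((adjCount σ).choose r : ℝ)

lemma sum_powersetCard_adjAt (σ : Equiv.Perm (Fin N)) (r : ℕ) (c : ℝ) {g : Finset (Fin N) → ℝ}
    (h1 : ∀ I ∈ powersetCard r univ, (∀ j ∈ I, AdjAt σ j) → g I = c)
    (h0 : ∀ I, (¬ ∀ j ∈ I, AdjAt σ j) → g I = 0) :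
    ∑ I ∈ powersetCard r univ, g I = (adjCount σ).choose r * c := by
  have hsub : powersetCard r (univ.filter (AdjAt σ)) ⊆ powersetCard r univ :=
    powersetCard_mono (subset_univ _)
  have hmem : ∀ I : Finset (Fin N), I ⊆ univ.filter (AdjAt σ) ↔ ∀ j ∈ I, AdjAt σ j := by
    simp [subset_iff]
  rw [adjCount_eq_card, ← card_powersetCard, ← nsmul_eq_mul, ← Finset.sum_const,
    ← Finset.sum_subset hsub fun I hI hI' => h0 I fun h =>
      hI' (mem_powersetCard.2 ⟨(hmem I).2 h, (mem_powersetCard.1 hI).2⟩)]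
  exact Finset.sum_congr rfl fun I hI =>
    h1 I (hsub hI) ((hmem I).1 (mem_powersetCard.1 hI).1)

lemma adjMoment_eq_sum (w : Equiv.Perm (Fin N) → ℝ) (r : ℕ) :
    adjMoment w r = ∑ I ∈ powersetCard r univ, mass w (fun σ => ∀ j ∈ I, AdjAt σ j) := by
  simp only [mass, adjMoment]
  rw [Finset.sum_comm]
  refine Finset.sum_congr rfl fun σ _ => ?_
  rw [mul_comm]
  exact (sum_powersetCard_adjAt σ r (w σ) (fun I _ h => if_pos h) fun I h => if_neg h).symm

lemma succ_mul_adjMoment_succ (w : Equiv.Perm (Fin N) → ℝ) (r : ℕ) :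
    (r + 1) * adjMoment w (r + 1) = ∑ I ∈ powersetCard r univ, ∑ i ∈ univ.filter (· ∉ I),
      mass w (fun σ => (∀ j ∈ I, AdjAt σ j) ∧ AdjAt σ i) := by
  simp only [mass, adjMoment]
  rw [Finset.sum_congr rfl fun I _ => Finset.sum_comm, Finset.sum_comm, Finset.mul_sum]
  refine Finset.sum_congr rfl fun σ _ => ?_
  rw [sum_powersetCard_adjAt σ r (((adjCount σ - r : ℕ) : ℝ) * w σ), ← mul_assoc,
    ← mul_assoc, ← Nat.cast_mul, ← Nat.choose_succ_right_eq]
  · push_cast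
    ring
  · intro I hI h
    have hsub : I ⊆ univ.filter (AdjAt σ) := fun j hj => by simpa using h j hj
    rw [adjCount_eq_card, ← (mem_powersetCard.1 hI).2, ← Finset.card_sdiff_of_subset hsub,
      ← nsmul_eq_mul, ← Finset.sum_const, ← Finset.sum_subset (s₁ := univ.filter (AdjAt σ) \ I)]
    · refine Finset.sum_congr rfl fun i hi => if_pos ⟨h, ?_⟩
      simpa using (mem_sdiff.1 hi).1
    · intro i hi
      simpa using (mem_sdiff.1 hi).2
    · intro i hi hi'
      refine if_neg fun h' => hi' ?_
      simp only [mem_filter, mem_univ, true_and, mem_sdiff] at hi ⊢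
      exact ⟨h'.2, hi⟩
  · exact fun I h => Finset.sum_eq_zero fun i _ => if_neg fun h' => h h'.1

/-- The constant in `IsQuasiUniform.abs_adjMoment_succ`. -/
def momentConst (K : ℝ) (r : ℕ) : ℝ :=
  (2 * shiftConst K (2 * r) + (4 * r + 1) * (4 * K + 2)) * (4 * K) ^ r

lemma shiftConst_nonneg (hK : 0 ≤ K) (m : ℕ) : 0 ≤ shiftConst K m := by
  rw [shiftConst]
  positivity

lemma IsQuasiUniform.abs_sum_mass_adjAt (hw : IsQuasiUniform K w) (hK : 0 ≤ K)
    (h1 : mass w (fun _ => True) = 1) {I : Finset (Fin N)} {r : ℕ} (hI : I.card = r)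
    (hN : 8 * r + 8 ≤ N) :
    |∑ i ∈ univ.filter (· ∉ I), mass w (fun σ => (∀ j ∈ I, AdjAt σ j) ∧ AdjAt σ i) -
      2 * mass w (fun σ => ∀ j ∈ I, AdjAt σ j)| ≤ momentConst K r / N * (1 / N) ^ r := by
  have hN0 : (0 : ℝ) < N := by exact_mod_cast (by omega : 0 < N)
  set x := mass w (fun σ => ∀ j ∈ I, AdjAt σ j) with hx
  have hx0 : 0 ≤ x := mass_nonneg hw.nonneg _
  have hxr : x ≤ (4 * K / N) ^ r := by
    have := hw.mass_adjAt_le hK I (by omega)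
    rwa [h1, mul_one, hI] at this
  set S := shiftConst K (2 * r) with hS
  have hS0 : 0 ≤ S := shiftConst_nonneg hK _
  set f : Fin N → ℝ := fun i => (if i ∉ I then
    mass w (fun σ => (∀ j ∈ I, AdjAt σ j) ∧ AdjAt σ i) else 0) - 2 / N * x with hf
  set bad : Finset (Fin N) := (adjPositions I ∪ (adjPositions I).image (finRotate N).symm) ∪
    univ.filter (fun i : Fin N => (i : ℕ) + 1 = N) with hbad
  have hbadc : bad.card ≤ 4 * r + 1 := by
    have h2 : (univ.filter (fun i : Fin N => (i : ℕ) + 1 = N)).card ≤ 1 := by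
      refine Finset.card_le_one.2 fun a ha b hb => ?_
      simp only [mem_filter, mem_univ, true_and] at ha hb
      ext
      omega
    have h3 := card_adjPositions_le I
    have h4 := Finset.card_image_le (s := adjPositions I) (f := (finRotate N).symm)
    have h5 := Finset.card_union_le (adjPositions I) ((adjPositions I).image (finRotate N).symm)
    have h6 := Finset.card_union_le
      (adjPositions I ∪ (adjPositions I).image (finRotate N).symm)
      (univ.filter (fun i : Fin N => (i : ℕ) + 1 = N))
    rw [← hbad] at h6
    rw [hI] at h3
    omega
  have hgood : ∀ i, i ∉ bad → |f i| ≤ 2 * S / N ^ 2 * x := by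
    intro i hi
    simp only [hbad, mem_union, mem_filter, mem_univ, true_and, not_or, mem_image,
      not_exists, not_and] at hi
    obtain ⟨⟨hi1, hi2⟩, hi3⟩ := hi
    have hiI : i ∉ I := fun h => hi1 (Finset.mem_union_left _ h)
    have h := hw.abs_mass_adjAt hK hI hN (i := i) (by have := i.isLt; omega) hi1
      (fun h => hi2 _ h (Equiv.symm_apply_apply _ _))
    rw [← hx, ← hS] at h
    simp only [hf, hiI, not_false_eq_true, if_true]
    set y := mass w (fun σ => (∀ j ∈ I, AdjAt σ j) ∧ AdjAt σ i)
    have e : y - 2 / N * x = (N * y - 2 * x) / N := by field_simp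
    rw [e, abs_div, abs_of_pos hN0, div_le_iff₀ hN0]
    refine h.trans_eq ?_
    field_simp
  have hall : ∀ i, |f i| ≤ (4 * K / N) ^ (r + 1) + 2 / N * x := by
    intro i
    have h2 : 0 ≤ 2 / N * x := by positivity
    have h3 : 0 ≤ (4 * K / N) ^ (r + 1) := by positivity
    simp only [hf]
    split_ifs with hiI
    · rw [zero_sub, abs_neg, abs_of_nonneg h2]
      linarith
    · have h4 := hw.mass_adjAt_le hK (insert i I)
        (by rw [Finset.card_insert_of_notMem hiI]; omega)
      rw [Finset.card_insert_of_notMem hiI, h1, mul_one, hI] at h4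
      have h5 : mass w (fun σ => (∀ j ∈ I, AdjAt σ j) ∧ AdjAt σ i) ≤
          mass w (fun σ => ∀ j ∈ insert i I, AdjAt σ j) :=
        mass_mono hw.nonneg fun σ h j hj => by
          rcases Finset.mem_insert.1 hj with rfl | hj
          · exact h.2
          · exact h.1 j hj
      have h6 := mass_nonneg hw.nonneg (fun σ => (∀ j ∈ I, AdjAt σ j) ∧ AdjAt σ i)
      rw [abs_le]
      constructor <;> linarith
  have e : ∑ i ∈ univ.filter (· ∉ I), mass w (fun σ => (∀ j ∈ I, AdjAt σ j) ∧ AdjAt σ i) -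
      2 * x = ∑ i, f i := by
    simp only [hf]
    rw [Finset.sum_sub_distrib, Finset.sum_filter, Finset.sum_const, Finset.card_univ,
      Fintype.card_fin, nsmul_eq_mul]
    field_simp
  rw [e]
  calc |∑ i, f i| ≤ ∑ i, |f i| := Finset.abs_sum_le_sum_abs _ _
    _ ≤ ∑ i : Fin N, (2 * S / N ^ 2 * x +
        if i ∈ bad then (4 * K / N) ^ (r + 1) + 2 / N * x else 0) := by
      refine Finset.sum_le_sum fun i _ => ?_
      have : 0 ≤ 2 * S / N ^ 2 * x := by positivity
      split_ifs with hi
      · linarith [hall i]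
      · linarith [hgood i hi]
    _ = 2 * S / N * x + bad.card * ((4 * K / N) ^ (r + 1) + 2 / N * x) := by
      rw [Finset.sum_add_distrib, Finset.sum_const, Finset.card_univ, Fintype.card_fin,
        nsmul_eq_mul, ← Finset.sum_filter, Finset.sum_const, nsmul_eq_mul]
      congr 1
      · field_simp
      · simp
    _ ≤ 2 * S / N * (4 * K / N) ^ r +
        (4 * r + 1 : ℕ) * ((4 * K / N) ^ (r + 1) + 2 / N * (4 * K / N) ^ r) := by
      gcongr
    _ = _ := by
      rw [momentConst, ← hS, div_pow, pow_succ, div_pow, one_div, inv_pow]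
      push_cast
      field_simp

lemma IsQuasiUniform.abs_adjMoment_succ (hw : IsQuasiUniform K w) (hK : 0 ≤ K)
    (h1 : mass w (fun _ => True) = 1) {r : ℕ} (hN : 8 * r + 8 ≤ N) :
    |(r + 1) * adjMoment w (r + 1) - 2 * adjMoment w r| ≤ momentConst K r / N := by
  have hN0 : (0 : ℝ) < N := by exact_mod_cast (by omega : 0 < N)
  have hC : 0 ≤ momentConst K r := by
    have := shiftConst_nonneg hK (2 * r)
    rw [momentConst]
    positivity
  rw [succ_mul_adjMoment_succ, adjMoment_eq_sum, Finset.mul_sum, ← Finset.sum_sub_distrib]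
  calc _ ≤ ∑ I ∈ powersetCard r (univ : Finset (Fin N)),
        momentConst K r / N * (1 / N) ^ r :=
      (Finset.abs_sum_le_sum_abs _ _).trans (Finset.sum_le_sum fun I hI =>
        hw.abs_sum_mass_adjAt hK h1 (mem_powersetCard.1 hI).2 hN)
    _ = (N.choose r : ℝ) * (momentConst K r / N * (1 / N) ^ r) := by
      rw [Finset.sum_const, card_powersetCard, Finset.card_univ, Fintype.card_fin, nsmul_eq_mul]
    _ ≤ (N : ℝ) ^ r * (momentConst K r / N * (1 / N) ^ r) := by
      gcongr
      exact_mod_cast Nat.choose_le_pow N r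
    _ = _ := by
      rw [one_div, inv_pow]
      field_simp

end Mass

lemma abs_ite_sub_alternating_sum_choose_le (n m : ℕ) :
    |(if n = 0 then (1 : ℝ) else 0) - ∑ j ∈ range m, (-1) ^ j * (n.choose j : ℝ)| ≤
      n.choose m := by
  rcases m with _ | m
  · split_ifs <;> simp
  rcases n with _ | n
  · simp [Finset.sum_range_succ']
  · have h : ∑ j ∈ range (m + 1), (-1) ^ j * ((n + 1).choose j : ℝ) = (-1) ^ m * n.choose m := by
      exact_mod_cast Int.alternating_sum_range_choose_eq_choose (n := n) (m := m)
    rw [h, if_neg n.succ_ne_zero, zero_sub, abs_neg, abs_mul, abs_pow, abs_neg, abs_one, one_pow,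
      one_mul, Nat.abs_cast, Nat.choose_succ_succ]
    exact_mod_cast Nat.le_add_right _ _

/-- Bonferroni inequality for the event that a counting variable takes the value `k`. -/
lemma abs_ite_eq_sub_alternating_sum_le (a k m : ℕ) :
    |(if a = k then (1 : ℝ) else 0) -
      ∑ j ∈ range m, (-1) ^ j * ((k + j).choose k * a.choose (k + j) : ℝ)| ≤
      (k + m).choose k * a.choose (k + m) := by
  have hmul : ∀ j, ((k + j).choose k * a.choose (k + j) : ℝ) =
      a.choose k * (a - k).choose j := by
    intro j
    have := Nat.choose_mul (n := a) (Nat.le_add_right k j)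
    rw [Nat.add_sub_cancel_left, mul_comm] at this
    exact_mod_cast this
  have hite : (if a = k then (1 : ℝ) else 0) = a.choose k * (if a - k = 0 then 1 else 0) := by
    rcases lt_trichotomy a k with h | rfl | h
    · simp [Nat.choose_eq_zero_of_lt h, h.ne]
    · simp
    · rw [if_neg h.ne', if_neg (by omega), mul_zero]
  simp only [hmul]
  rw [hite, Finset.sum_congr rfl fun j _ => mul_left_comm _ _ _, ← Finset.mul_sum, ← mul_sub,
    abs_mul, Nat.abs_cast]
  exact mul_le_mul_of_nonneg_left (abs_ite_sub_alternating_sum_choose_le _ _) (Nat.cast_nonneg _)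

lemma choose_mul_pow_div_factorial (x : ℝ) (k j : ℕ) :
    ((k + j).choose k : ℝ) * (x ^ (k + j) / (k + j).factorial) =
      x ^ k / k.factorial * (x ^ j / j.factorial) := by
  have h : ((k + j).choose k : ℝ) * j.factorial * k.factorial = (k + j).factorial := by
    rw [add_comm k j]
    exact_mod_cast Nat.add_choose_mul_factorial_mul_factorial j k
  have h1 : ((k + j).choose k : ℝ) ≠ 0 :=
    Nat.cast_ne_zero.2 (Nat.choose_pos (Nat.le_add_right k j)).ne'
  rw [← h, pow_add]
  field_simp

/-- Method of binomial moments: sequences satisfying the Bonferroni inequalities converge to the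
Poisson weights as soon as the binomial moments converge to those of a Poisson variable. -/
lemma tendsto_poisson_of_binomial_moments {p : ℕ → ℝ} {M : ℕ → ℕ → ℝ} {x : ℝ} {k : ℕ}
    (hp : ∀ N m, |p N - ∑ j ∈ range m, (-1) ^ j * ((k + j).choose k * M N (k + j))| ≤
      (k + m).choose k * M N (k + m))
    (hM : ∀ r, Filter.Tendsto (fun N => M N r) Filter.atTop (nhds (x ^ r / r.factorial))) :
    Filter.Tendsto p Filter.atTop (nhds (Real.exp (-x) * x ^ k / k.factorial)) := by
  set c := x ^ k / k.factorial with hc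
  have hL : Filter.Tendsto (fun m => ∑ j ∈ range m, (-1) ^ j * (c * (x ^ j / j.factorial)))
      Filter.atTop (nhds (Real.exp (-x) * x ^ k / k.factorial)) := by
    have h := ((NormedSpace.expSeries_div_hasSum_exp (-x)).mul_left c).tendsto_sum_nat
    rw [← Real.exp_eq_exp_ℝ] at h
    convert h using 1
    · ext m
      refine Finset.sum_congr rfl fun j _ => ?_
      rw [neg_pow x j]
      ring
    · rw [hc]
      congr 1
      ring
  have hE : Filter.Tendsto (fun m => c * (x ^ m / m.factorial)) Filter.atTop (nhds 0) := by
    simpa using (FloorSemiring.tendsto_pow_div_factorial_atTop x).const_mul c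
  rw [Metric.tendsto_nhds]
  intro ε hε
  obtain ⟨m, hm1, hm2⟩ := ((Metric.tendsto_nhds.1 hL (ε / 3) (by positivity)).and
    (hE.eventually_lt_const (by positivity : (0 : ℝ) < ε / 3))).exists
  have hS : Filter.Tendsto
      (fun N => ∑ j ∈ range m, (-1) ^ j * ((k + j).choose k * M N (k + j))) Filter.atTop
      (nhds (∑ j ∈ range m, (-1) ^ j * (c * (x ^ j / j.factorial)))) := by
    refine tendsto_finsetSum _ fun j _ => Filter.Tendsto.const_mul _ ?_
    rw [hc, ← choose_mul_pow_div_factorial]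
    exact (hM _).const_mul _
  have hR : Filter.Tendsto (fun N => (k + m).choose k * M N (k + m)) Filter.atTop
      (nhds (c * (x ^ m / m.factorial))) := by
    rw [hc, ← choose_mul_pow_div_factorial]
    exact (hM _).const_mul _
  filter_upwards [Metric.tendsto_nhds.1 hS (ε / 3) (by positivity),
    hR.eventually_lt_const hm2] with N h1 h2
  rw [Real.dist_eq, abs_lt] at *
  have h3 := abs_le.1 (hp N m)
  constructor <;> linarith

/-- The density of the Ewens measure. -/
def ewensWeight (θ : ℝ) (N : ℕ) (σ : Equiv.Perm (Fin N)) : ℝ :=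
  θ ^ cycleCount σ / ∏ k ∈ range N, (θ + (k : ℝ))

lemma ewensE_eq_sum (θ : ℝ) (N : ℕ) (f : Equiv.Perm (Fin N) → ℝ) :
    ewensE θ N f = ∑ σ, ewensWeight θ N σ * f σ := by
  rw [ewensE, Finset.sum_div]
  exact Finset.sum_congr rfl fun σ _ => mul_div_right_comm _ _ _

lemma prod_add_range_pos {θ : ℝ} (hθ : 0 < θ) (N : ℕ) : 0 < ∏ k ∈ range N, (θ + (k : ℝ)) :=
  Finset.prod_pos fun _ _ => by positivity

lemma mass_ewensWeight_true {θ : ℝ} (hθ : 0 < θ) (N : ℕ) :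
    mass (ewensWeight θ N) (fun _ => True) = 1 := by
  simp only [mass, if_true, ewensWeight]
  rw [← Finset.sum_div, sum_pow_cycleCount, div_self (prod_add_range_pos hθ N).ne']

lemma isQuasiUniform_ewensWeight {θ : ℝ} (hθ : 0 < θ) (N : ℕ) :
    IsQuasiUniform (1 + θ + θ⁻¹) (ewensWeight θ N) where
  nonneg σ := div_nonneg (by positivity) (prod_add_range_pos hθ N).le
  conj σ b c := by
    have := cycleCount_conj σ (Equiv.swap b c)
    rw [Equiv.swap_inv] at this
    rw [ewensWeight, this, ewensWeight]
  le_swap σ b c := by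
    rw [ewensWeight, ewensWeight, ← mul_div_assoc]
    exact div_le_div_of_nonneg_right (pow_cycleCount_le hθ σ b c) (prod_add_range_pos hθ N).le

lemma tendsto_adjMoment_ewensWeight {θ : ℝ} (hθ : 0 < θ) (r : ℕ) :
    Filter.Tendsto (fun N => adjMoment (ewensWeight θ N) r) Filter.atTop
      (nhds (2 ^ r / r.factorial)) := by
  induction r with
  | zero =>
    have : ∀ N, adjMoment (ewensWeight θ N) 0 = 1 := fun N => by
      simpa [mass, adjMoment] using mass_ewensWeight_true hθ N
    simp [this]
  | succ r ih =>
    have h0 : Filter.Tendsto (fun N : ℕ => (r + 1) * adjMoment (ewensWeight θ N) (r + 1) -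
        2 * adjMoment (ewensWeight θ N) r) Filter.atTop (nhds 0) := by
      refine squeeze_zero_norm' ?_
        (tendsto_const_div_atTop_nhds_zero_nat (momentConst (1 + θ + θ⁻¹) r))
      filter_upwards [Filter.eventually_ge_atTop (8 * r + 8)] with N hN
      exact (isQuasiUniform_ewensWeight hθ N).abs_adjMoment_succ (by positivity)
        (mass_ewensWeight_true hθ N) hN
    have h1 := (h0.add (ih.const_mul 2)).div_const ((r : ℝ) + 1)
    have hr : (r : ℝ) + 1 ≠ 0 := by positivity
    convert h1 using 1
    · ext N
      field_simp
      ring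
    · rw [Nat.factorial_succ, pow_succ]
      push_cast
      congr 1
      field_simp
      ring

/-- Theorem 5.1: the number of adjacencies of an Ewens(θ) random permutation converges in
distribution to a Poisson law with parameter 2. -/
theorem adjacencies_to_poisson (θ : ℝ) (hθ : 0 < θ) (k : ℕ) :
    Filter.Tendsto (fun N => ewensP θ N {σ | adjCount σ = k}) Filter.atTop
      (nhds (Real.exp (-2) * 2 ^ k / (Nat.factorial k : ℝ))) := by
  refine tendsto_poisson_of_binomial_moments (M := fun N => adjMoment (ewensWeight θ N))
    (fun N m => ?_) (tendsto_adjMoment_ewensWeight hθ)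
  have hw := (isQuasiUniform_ewensWeight hθ N).nonneg
  calc _ = |∑ σ : Equiv.Perm (Fin N), ewensWeight θ N σ *
        ((if adjCount σ = k then (1 : ℝ) else 0) -
        ∑ j ∈ range m, (-1) ^ j * ((k + j).choose k * (adjCount σ).choose (k + j) : ℝ))| := by
        congr 1
        simp only [ewensP, ewensE_eq_sum, Set.mem_ofPred_eq, adjMoment, mul_sub,
          Finset.sum_sub_distrib, Finset.mul_sum]
        rw [Finset.sum_comm]
        refine congrArg₂ _ (Finset.sum_congr rfl fun σ _ => by congr) ?_
        exact Finset.sum_congr rfl fun σ _ => Finset.sum_congr rfl fun j _ => by ring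
    _ ≤ ∑ σ, ewensWeight θ N σ * ((k + m).choose k * (adjCount σ).choose (k + m)) := by
        refine (Finset.abs_sum_le_sum_abs _ _).trans (Finset.sum_le_sum fun σ _ => ?_)
        rw [abs_mul, abs_of_nonneg (hw σ)]
        exact mul_le_mul_of_nonneg_left (abs_ite_eq_sub_alternating_sum_le _ _ _) (hw σ)
    _ = _ := by
        simp only [adjMoment, Finset.mul_sum]
        exact Finset.sum_congr rfl fun σ _ => mul_left_comm _ _ _

end
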